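/- Let a > 0 and fix t ∈ ℝ. Define on [0,∞) the functions θ(t,x) = 3 a sinh(a t) cosh(a t)⁻³ cosh(3 a x)⁻¹ and h(x) = cosh(3 a x)^{1/3} sinh(3 a x). Then the spatial average of the fluid expansion on the t = const slice vanishes: (∫₀^R θ(t,x) h(x) dx) / (∫₀^R h(x) dx) → 0 as R → ∞. -/

import Mathlib

open MeasureTheory Filter intervalIntegral Real

/-- `∫₀ᴿ cosh(bx)^r sinh(bx) dx = (cosh(bR)^(r+1) - 1) / (b(r+1))`. -/
theorem integral_cosh_rpow_mul_sinh {b r : ℝ} (hb : b ≠ 0) (hr : r + 1 ≠ 0) (R : ℝ) :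
    ∫ x in (0:ℝ)..R, Real.cosh (b * x) ^ r * Real.sinh (b * x) =
      (Real.cosh (b * R) ^ (r + 1) - 1) / (b * (r + 1)) := by
  have hderiv (x : ℝ) : HasDerivAt (fun y => Real.cosh (b * y) ^ (r + 1) / (b * (r + 1)))
      (Real.cosh (b * x) ^ r * Real.sinh (b * x)) x := by
    have hlin : HasDerivAt (fun y : ℝ => b * y) b x := by
      simpa using (hasDerivAt_id x).const_mul b
    have hpow := (hlin.cosh.rpow_const (p := r + 1)
      (Or.inl (Real.cosh_pos _).ne')).div_const (b * (r + 1))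
    refine hpow.congr_deriv ?_
    rw [add_sub_cancel_right]
    field_simp
  have hcont : Continuous fun x : ℝ => Real.cosh (b * x) ^ r * Real.sinh (b * x) :=
    (Continuous.rpow_const (by fun_prop) fun x => Or.inl (Real.cosh_pos _).ne').mul (by fun_prop)
  rw [integral_eq_sub_of_hasDerivAt (fun x _ => hderiv x) (hcont.intervalIntegrable _ _)]
  simp [sub_div]

theorem tendsto_cosh_atTop_atTop : Tendsto Real.cosh atTop atTop :=
  tendsto_atTop_mono' atTop
    ((eventually_ge_atTop 0).mono fun x hx =>
      (Real.self_le_sinh_iff.2 hx).trans (Real.sinh_lt_cosh x).le) tendsto_id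

/-- The spatial average of the fluid expansion
`θ(t,x) = 3a sinh(at) cosh(at)⁻³ cosh(3ax)⁻¹` of the singularity-free solution on any
`t = const` slice, taken with the spatial volume density
`h(x) = cosh(3ax)^{1/3} sinh(3ax)`, vanishes. -/
theorem spatial_average_expansion_vanishes
    (a : ℝ) (ha : 0 < a) (t : ℝ)
    (θ : ℝ → ℝ → ℝ) (h : ℝ → ℝ)
    (hθ : ∀ s x, θ s x = 3 * a * Real.sinh (a * s) * (Real.cosh (a * s)) ^ (-3 : ℝ) *
      (Real.cosh (3 * a * x)) ^ (-1 : ℝ))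
    (hh : ∀ x, h x = (Real.cosh (3 * a * x)) ^ ((1 : ℝ) / 3) * Real.sinh (3 * a * x)) :
    Tendsto
      (fun R : ℝ => (∫ x in (0:ℝ)..R, θ t x * h x) / ∫ x in (0:ℝ)..R, h x)
      atTop (nhds 0) := by
  set K := 3 * a * Real.sinh (a * t) * Real.cosh (a * t) ^ (-3 : ℝ) with hK
  set u : ℝ → ℝ := fun R => Real.cosh (3 * a * R) ^ ((1 : ℝ) / 3) with hu
  have hb : 3 * a ≠ 0 := by positivity
  have hu_top : Tendsto u atTop atTop :=
    (tendsto_rpow_atTop (by norm_num)).comp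
      (tendsto_cosh_atTop_atTop.comp (tendsto_id.const_mul_atTop (by positivity)))
  have hden (R : ℝ) : ∫ x in (0:ℝ)..R, h x = (u R ^ 4 - 1) / (4 * a) := by
    simp_rw [hh]
    rw [integral_cosh_rpow_mul_sinh hb (by norm_num), hu, ← Real.rpow_mul_natCast
      (Real.cosh_pos _).le]
    norm_num
    ring
  have hnum (R : ℝ) : ∫ x in (0:ℝ)..R, θ t x * h x = K * ((u R - 1) / a) := by
    have hint (x : ℝ) : θ t x * h x =
        K * (Real.cosh (3 * a * x) ^ (-2 / 3 : ℝ) * Real.sinh (3 * a * x)) := by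
      rw [hθ, hh, ← hK, show (-2 / 3 : ℝ) = -1 + 1 / 3 by norm_num,
        Real.rpow_add (Real.cosh_pos _)]
      ring
    simp_rw [hint]
    rw [intervalIntegral.integral_const_mul, integral_cosh_rpow_mul_sinh hb (by norm_num), hu]
    norm_num
    left
    ring
  have hlim : Tendsto (fun R => 4 * K * (1 + u R + u R ^ 2 + u R ^ 3)⁻¹) atTop (nhds 0) := by
    have hinv : Tendsto (fun R => (1 + u R + u R ^ 2 + u R ^ 3)⁻¹) atTop (nhds 0) := by
      refine tendsto_inv_atTop_zero.comp (tendsto_atTop_mono' atTop ?_ hu_top)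
      filter_upwards [hu_top.eventually_ge_atTop 0] with R hR
      nlinarith [pow_nonneg hR 2, pow_nonneg hR 3]
    simpa using hinv.const_mul (4 * K)
  refine hlim.congr' ?_
  filter_upwards [hu_top.eventually_gt_atTop 1] with R hR
  have hsub : u R - 1 ≠ 0 := (sub_pos.2 hR).ne'
  have hsum : 1 + u R + u R ^ 2 + u R ^ 3 ≠ 0 := by positivity
  rw [hnum, hden, show u R ^ 4 - 1 = (u R - 1) * (1 + u R + u R ^ 2 + u R ^ 3) by ring]
  field_simp
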